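/- arXiv:2604.20415 — 3 statements merged into one kernel-verified Lean document; each statement's English description precedes it below -/
import Mathlib

section
/- Let K be a field, σ a ring automorphism of K, and set C := Fix(σ) = {x ∈ K : σ(x) = x}. Suppose there exists an intermediate field C′ of K/C which is a finite Galois extension of C of degree n. Then the extension Fix(σⁿ)/C has degree exactly n, i.e. [Fix(σⁿ) : C] = n. -/
/-- The fixed subfield of a ring automorphism `σ` of a field `K`. -/
def fixSubfield {K : Type*} [Field K] (σ : K ≃+* K) : Subfield K where
  carrier := {x : K | σ x = x}
  mul_mem' := by
    intro a b ha hb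
    simp only [Set.mem_setOf_eq] at *
    rw [map_mul, ha, hb]
  one_mem' := map_one σ
  add_mem' := by
    intro a b ha hb
    simp only [Set.mem_setOf_eq] at *
    rw [map_add, ha, hb]
  zero_mem' := map_zero σ
  neg_mem' := by
    intro a ha
    simp only [Set.mem_setOf_eq] at *
    rw [map_neg, ha]
  inv_mem' := by
    intro x hx
    simp only [Set.mem_setOf_eq] at *
    rw [map_inv₀, hx]

theorem fixSubfield_pow {K : Type*} [Field K] {σ : K ≃+* K} {x : K}
    (hx : σ x = x) (n : ℕ) : (σ ^ n) x = x := by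
  induction n with
  | zero => rfl
  | succ n ih =>
    rw [pow_succ]
    show (σ ^ n) (σ x) = x
    rw [hx, ih]

/-- The fixed field of `σ ^ n`, as an intermediate field of `K` over `Fix σ`. -/
def fixPowIntermediateField {K : Type*} [Field K] (σ : K ≃+* K) (n : ℕ) :
    IntermediateField (fixSubfield σ) K where
  carrier := {x : K | (σ ^ n) x = x}
  mul_mem' := by
    intro a b ha hb
    simp only [Set.mem_setOf_eq] at *
    rw [map_mul, ha, hb]
  one_mem' := map_one _
  add_mem' := by
    intro a b ha hb
    simp only [Set.mem_setOf_eq] at *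
    rw [map_add, ha, hb]
  zero_mem' := map_zero _
  algebraMap_mem' := fun c => fixSubfield_pow c.2 n
  inv_mem' := by
    intro x hx
    simp only [Set.mem_setOf_eq] at *
    rw [map_inv₀, hx]

set_option synthInstance.maxHeartbeats 1000000 in
/-- If there exists an intermediate field of `K / Fix(σ)` which is a finite Galois extension
of `Fix(σ)` of degree `n`, then `[Fix(σⁿ) : Fix(σ)] = n`. -/
theorem statement3 {K : Type*} [Field K] (σ : K ≃+* K) (n : ℕ) (hn : 1 ≤ n)
    (h : ∃ C' : IntermediateField (fixSubfield σ) K,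
      FiniteDimensional (fixSubfield σ) C' ∧ IsGalois (fixSubfield σ) C' ∧
      Module.finrank (fixSubfield σ) C' = n) :
    Module.finrank (fixSubfield σ) (fixPowIntermediateField σ n) = n := by
  obtain ⟨C', hfd, hgal, hdeg⟩ := h
  let s : K ≃ₐ[fixSubfield σ] K := AlgEquiv.ofRingEquiv (f := σ) (fun c => c.2)
  have hs : ∀ (m : ℕ) (x : K), (s ^ m) x = (σ ^ m) x := by
    intro m
    induction m with
    | zero => intro x; rfl
    | succ m ih =>
      intro x
      rw [pow_succ, pow_succ, AlgEquiv.mul_apply, RingAut.mul_apply, ih]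
      rfl
  have hle : C' ≤ fixPowIntermediateField σ n := by
    intro x hx
    change (σ ^ n) x = x
    have h1 : (AlgEquiv.restrictNormalHom C' s) ^ n = 1 := by
      rw [← hdeg, ← IsGalois.card_aut_eq_finrank]
      exact pow_card_eq_one'
    rw [← map_pow] at h1
    have h2 := AlgEquiv.restrictNormalHom_apply C' (s ^ n) ⟨x, hx⟩
    rw [h1, hs] at h2
    exact h2.symm
  have hmem : ∀ x : K, x ∈ fixPowIntermediateField σ n ↔ (s ^ n) x = x := by
    intro x; rw [hs]; rfl
  generalize fixPowIntermediateField σ n = F at *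
  have hmap : F.map s.toAlgHom = F := by
    ext y
    rw [IntermediateField.mem_map]
    constructor
    · rintro ⟨x, hx, rfl⟩
      rw [hmem] at hx ⊢
      change (s ^ n) (s x) = s x
      rw [← AlgEquiv.mul_apply, ← pow_succ, pow_succ', AlgEquiv.mul_apply, hx]
    · intro hy
      refine ⟨s.symm y, ?_, s.apply_symm_apply y⟩
      rw [hmem] at hy ⊢
      apply s.injective
      rw [← AlgEquiv.mul_apply, ← pow_succ', pow_succ, AlgEquiv.mul_apply, s.apply_symm_apply, hy]
  let t : F ≃ₐ[fixSubfield σ] F :=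
    (F.equivMap s.toAlgHom).trans (IntermediateField.equivOfEq hmap)
  have ht : ∀ x : F, ((t x : F) : K) = s x := fun x => rfl
  have htm : ∀ (m : ℕ) (x : F), (((t ^ m) x : F) : K) = (s ^ m) x := by
    intro m
    induction m with
    | zero => intro x; rfl
    | succ m ih =>
      intro x
      rw [pow_succ, pow_succ, AlgEquiv.mul_apply, AlgEquiv.mul_apply, ih, ht]
  have htn : t ^ n = 1 := by
    ext x
    rw [htm]
    exact (hmem x).1 x.2
  have hfin : IsOfFinOrder t := isOfFinOrder_iff_pow_eq_one.2 ⟨n, hn, htn⟩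
  have : Finite (Subgroup.zpowers t) := hfin.finite_zpowers
  have hinv : Algebra.IsInvariant (fixSubfield σ) F (Subgroup.zpowers t) := by
    refine ⟨fun b hb => ?_⟩
    have h1 : t b = b := hb ⟨t, Subgroup.mem_zpowers t⟩
    have h2 : σ (b : K) = b := congrArg Subtype.val h1
    exact ⟨⟨b, h2⟩, rfl⟩
  have hG : IsGaloisGroup (Subgroup.zpowers t) (fixSubfield σ) F :=
    { faithful := inferInstance, commutes := inferInstance, isInvariant := hinv }
  have hFD : FiniteDimensional (fixSubfield σ) F := IsGaloisGroup.finiteDimensional (Subgroup.zpowers t) _ _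
  have hc := IsGaloisGroup.card_eq_finrank (Subgroup.zpowers t) (fixSubfield σ) F
  rw [Nat.card_zpowers] at hc
  apply le_antisymm
  · rw [← hc]
    exact orderOf_le_of_pow_eq_one hn htn
  · rw [← hdeg]
    exact LinearMap.finrank_le_finrank_of_injective
      (f := (IntermediateField.inclusion hle).toLinearMap)
      (IntermediateField.inclusion_injective hle)
end

section
/- Let K be an algebraically closed field and σ a ring automorphism of K such that the fixed subfield C := Fix(σ) = {x ∈ K : σ(x) = x} is pseudofinite. Then for every integer n ≥ 1 the extension Fix(σⁿ)/C has degree exactly n; consequently, for all integers n ≠ m with n, m ≥ 1, one has Fix(σⁿ) ≠ Fix(σᵐ). -/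
/-- A field is pseudofinite if it is infinite and satisfies every first-order sentence in
the language of rings that holds in all finite fields. -/
def IsPseudofiniteField (C : Type*) [Field C] : Prop :=
  Infinite C ∧
    ∀ φ : FirstOrder.Language.ring.Sentence,
      (∀ (F : Type) [Field F] [Fintype F],
        @FirstOrder.Language.Sentence.Realize FirstOrder.Language.ring F
          (FirstOrder.Ring.compatibleRingOfRing F).toStructure φ) →
      @FirstOrder.Language.Sentence.Realize FirstOrder.Language.ring C
        (FirstOrder.Ring.compatibleRingOfRing C).toStructure φ

open Polynomial in
/-- polynomial with prescribed coefficients -/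
noncomputable def s4gen {R : Type*} [CommRing R] {n : ℕ} (c : Fin n → R) : R[X] :=
  ∑ i, C (c i) * X ^ (i : ℕ)

open Polynomial in
theorem s4gen_map {R S : Type*} [CommRing R] [CommRing S] (f : R →+* S) {n : ℕ} (c : Fin n → R) :
    (s4gen c).map f = s4gen (fun i => f (c i)) := by
  simp [s4gen, Polynomial.map_sum]

open Polynomial in
theorem s4gen_degree {R : Type*} [CommRing R] {n : ℕ} (c : Fin n → R) :
    (s4gen c).degree < n := by
  unfold s4gen
  exact degree_sum_fin_lt c

open Polynomial in
theorem s4gen_surj {R : Type*} [CommRing R] {n : ℕ} (p : R[X]) (h : p.degree < n) :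
    ∃ c : Fin n → R, s4gen c = p := by
  refine ⟨fun i => p.coeff i, ?_⟩
  unfold s4gen
  by_cases hp : p = 0
  · simp [hp]
  · conv_rhs => rw [p.as_sum_range' n ((natDegree_lt_iff_degree_lt hp).2 h)]
    rw [Finset.sum_range]
    simp [C_mul_X_pow_eq_monomial]

open Polynomial in
/-- difference polynomial -/
noncomputable def s4diff {R : Type*} [CommRing R] {n : ℕ} (c a b : Fin n → R) : R[X] :=
  X ^ n + s4gen c - s4gen a * s4gen b

open Polynomial in
theorem s4diff_map {R S : Type*} [CommRing R] [CommRing S] (f : R →+* S) {n : ℕ}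
    (c a b : Fin n → R) :
    (s4diff c a b).map f = s4diff (fun i => f (c i)) (fun i => f (a i)) (fun i => f (b i)) := by
  simp [s4diff, s4gen_map]

open Polynomial in
theorem s4diff_natDegree {R : Type*} [CommRing R] {n : ℕ} (c a b : Fin n → R) :
    (s4diff c a b).natDegree ≤ 2 * n := by
  have h : ∀ c : Fin n → R, (s4gen c).natDegree ≤ n := fun c =>
    natDegree_le_of_degree_le (s4gen_degree c).le
  unfold s4diff
  refine (natDegree_sub_le_of_le (natDegree_add_le_of_le (natDegree_X_pow_le n) (h c))
    (natDegree_mul_le_of_le (h a) (h b))).trans ?_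
  simp; omega

theorem s4diff_eq_zero {R : Type*} [CommRing R] {n : ℕ} (c a b : Fin n → R) :
    s4diff c a b = 0 ↔ ∀ j : Fin (2 * n + 1), (s4diff c a b).coeff j = 0 := by
  constructor
  · intro h; simp [h]
  · intro h
    ext j
    by_cases hj : j < 2 * n + 1
    · simpa using h ⟨j, hj⟩
    · rw [Polynomial.coeff_eq_zero_of_natDegree_lt]
      · simp
      · have := s4diff_natDegree c a b
        omega

open Polynomial in
theorem s4irr {F : Type*} [Field F] {n : ℕ} (hn : 1 ≤ n) (c : Fin n → F) :
    Irreducible (X ^ n + s4gen c) ↔ ∀ a b : Fin n → F, s4diff c a b ≠ 0 := by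
  have hd : (X ^ n + s4gen c : F[X]).degree = (n : WithBot ℕ) := by
    rw [degree_add_eq_left_of_degree_lt] <;> simp [s4gen_degree]
  constructor
  · intro h a b h0
    rw [s4diff, sub_eq_zero] at h0
    have ha := s4gen_degree a
    have hb := s4gen_degree b
    have hd' := hd
    rw [h0, degree_mul] at hd'
    rcases h.isUnit_or_isUnit h0 with hu | hu
    · rw [degree_eq_zero_of_isUnit hu, zero_add] at hd'
      exact hb.ne hd'
    · rw [degree_eq_zero_of_isUnit hu, add_zero] at hd'
      exact ha.ne hd'
  · intro h
    refine ⟨fun hu => ?_, ?_⟩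
    · have := degree_eq_zero_of_isUnit hu
      rw [hd] at this
      have : n = 0 := by exact_mod_cast this
      omega
    · intro p q hpq
      by_contra! hcon
      obtain ⟨hp, hq⟩ := hcon
      have hd' := hd
      have hne : (X ^ n + s4gen c : F[X]) ≠ 0 := by
        intro h0; rw [h0] at hd; simp at hd
      have hp0 : p ≠ 0 := by rintro rfl; simp at hpq; exact hne hpq
      have hq0 : q ≠ 0 := by rintro rfl; simp at hpq; exact hne hpq
      rw [isUnit_iff_degree_eq_zero, degree_eq_natDegree hp0] at hp
      rw [isUnit_iff_degree_eq_zero, degree_eq_natDegree hq0] at hq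
      rw [hpq, degree_mul, degree_eq_natDegree hp0, degree_eq_natDegree hq0] at hd'
      have e : p.natDegree + q.natDegree = n := by exact_mod_cast hd'
      have hp1 : p.natDegree ≠ 0 := by exact_mod_cast hp
      have hq1 : q.natDegree ≠ 0 := by exact_mod_cast hq
      obtain ⟨a, ha⟩ := s4gen_surj (n := n) p (by
        rw [degree_eq_natDegree hp0]; exact_mod_cast (by omega : p.natDegree < n))
      obtain ⟨b, hb⟩ := s4gen_surj (n := n) q (by
        rw [degree_eq_natDegree hq0]; exact_mod_cast (by omega : q.natDegree < n))
      apply h a b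
      rw [s4diff, ha, hb, hpq, sub_self]

open FirstOrder FirstOrder.Ring FirstOrder.Language in
/-- the sentence: there is an irreducible monic polynomial of degree `n` -/
noncomputable def s4sentence (n : ℕ) : Language.ring.Sentence :=
  Formula.iExs (α := Empty) (Fin n) (Formula.iAlls (Fin n ⊕ Fin n) (Formula.not (Formula.iInf
    (fun j : Fin (2 * n + 1) => Term.equal (termOfFreeCommRing
      ((s4diff (fun i => FreeCommRing.of (Sum.inl (Sum.inr i)))
        (fun i => FreeCommRing.of (Sum.inr (Sum.inl i)))
        (fun i => FreeCommRing.of (Sum.inr (Sum.inr i)))).coeff j)) 0))))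

open FirstOrder FirstOrder.Ring FirstOrder.Language Polynomial in
theorem s4sentence_realize {F : Type*} [Field F] [CompatibleRing F] {n : ℕ} (hn : 1 ≤ n) :
    F ⊨ s4sentence n ↔ ∃ c : Fin n → F, Irreducible (X ^ n + s4gen c) := by
  simp only [s4irr hn, Sentence.Realize, s4sentence, Formula.realize_iExs, Formula.realize_iAlls,
    Formula.realize_not, Formula.realize_iInf, Formula.realize_equal, realize_termOfFreeCommRing,
    ne_eq, realize_zero, ← Polynomial.coeff_map, s4diff_map, FreeCommRing.lift_of,
    Sum.elim_inl, Sum.elim_inr, ← s4diff_eq_zero]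
  refine exists_congr fun c => ⟨fun h a b => h (Sum.elim a b), fun h i => h _ _⟩

open Polynomial in
theorem s4exists_finite (F : Type) [Field F] [Fintype F] {n : ℕ} (hn : 1 ≤ n) :
    ∃ c : Fin n → F, Irreducible (X ^ n + s4gen c) := by
  obtain ⟨p, hp⟩ := CharP.exists F
  have : Fact p.Prime := ⟨CharP.char_is_prime F p⟩
  have : NeZero n := ⟨by omega⟩
  let := ZMod.algebra F p
  obtain ⟨x, hx⟩ := Field.exists_primitive_element F (FiniteField.Extension F p n)
  have hi : IsIntegral F x := Algebra.IsIntegral.isIntegral x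
  have hdeg : (minpoly F x).natDegree = n := by
    rw [← IntermediateField.adjoin.finrank hi, hx, IntermediateField.finrank_top',
      FiniteField.finrank_extension]
  have hm := minpoly.monic hi
  obtain ⟨c, hc⟩ := s4gen_surj (n := n) (minpoly F x - X ^ n) (by
    have h1 : (minpoly F x).degree = n := by
      rw [degree_eq_natDegree hm.ne_zero, hdeg]
    have := degree_sub_lt (p := minpoly F x) (q := X ^ n) (by rw [h1]; simp) hm.ne_zero
      (by simp [hm.leadingCoeff])
    rwa [h1] at this)
  refine ⟨c, ?_⟩
  rw [hc, add_sub_cancel]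
  exact minpoly.irreducible hi

open Polynomial in
theorem s4exists {C : Type*} [Field C] (hC : IsPseudofiniteField C) {n : ℕ} (hn : 1 ≤ n) :
    ∃ f : C[X], Irreducible f ∧ f.natDegree = n := by
  have h := hC.2 (s4sentence n) (fun F _ _ => by
    letI := FirstOrder.Ring.compatibleRingOfRing F
    exact (s4sentence_realize hn).2 (s4exists_finite F hn))
  letI := FirstOrder.Ring.compatibleRingOfRing C
  obtain ⟨c, hc⟩ := (s4sentence_realize hn).1 h
  refine ⟨_, hc, ?_⟩
  apply natDegree_eq_of_degree_eq_some
  rw [degree_add_eq_left_of_degree_lt] <;> simp [s4gen_degree]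

section
variable {K : Type*} [Field K] (σ : K ≃+* K) (n : ℕ)

theorem s4mem {x : K} : x ∈ fixPowIntermediateField σ n ↔ (σ ^ n) x = x := Iff.rfl

theorem s4comm (m : ℕ) (x : K) : (σ ^ n) ((σ ^ m) x) = (σ ^ m) ((σ ^ n) x) := by
  rw [← RingAut.mul_apply, ← RingAut.mul_apply, ← pow_add, ← pow_add, add_comm]

/-- restriction of σ -/
noncomputable def s4res : fixPowIntermediateField σ n →ₐ[fixSubfield σ] fixPowIntermediateField σ n where
  toFun x := ⟨σ x, by
    have := s4comm σ n 1 x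
    rw [pow_one, (s4mem σ n).1 x.2] at this
    exact this⟩
  map_one' := Subtype.ext (map_one σ)
  map_mul' x y := Subtype.ext (map_mul σ _ _)
  map_zero' := Subtype.ext (map_zero σ)
  map_add' x y := Subtype.ext (map_add σ _ _)
  commutes' c := Subtype.ext c.2

theorem s4res_pow (k : ℕ) (x : fixPowIntermediateField σ n) :
    (((s4res σ n) ^ k) x : K) = (σ ^ k) x := by
  induction k generalizing x with
  | zero => rfl
  | succ k ih =>
    rw [pow_succ, pow_succ, AlgHom.mul_apply, ih]
    rfl

theorem s4finrank (hn : 1 ≤ n) :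
    FiniteDimensional (fixSubfield σ) (fixPowIntermediateField σ n) ∧
    Module.finrank (fixSubfield σ) (fixPowIntermediateField σ n) ≤ n := by
  have hp : s4res σ n ^ n = 1 := by
    ext x
    rw [s4res_pow]
    exact x.2
  let u : (fixPowIntermediateField σ n →ₐ[fixSubfield σ] fixPowIntermediateField σ n)ˣ :=
    Units.ofPowEqOne _ n hp (by omega)
  let τ := AlgEquiv.algHomUnitsEquiv _ _ u
  have hτ : ∀ x, τ x = s4res σ n x := fun x => rfl
  have hτn : τ ^ n = 1 := by
    rw [← map_pow, Units.pow_ofPowEqOne, map_one]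
  have ho : orderOf τ ≤ n := orderOf_le_of_pow_eq_one hn hτn
  let G := Subgroup.zpowers τ
  have hfin : IsOfFinOrder τ := isOfFinOrder_iff_pow_eq_one.2 ⟨n, hn, hτn⟩
  have : Finite G := hfin.finite_zpowers
  have : IsGaloisGroup G (fixSubfield σ) (fixPowIntermediateField σ n) :=
    { faithful := inferInstance
      commutes := inferInstance
      isInvariant := ⟨fun b hb => by
        have := hb ⟨τ, Subgroup.mem_zpowers τ⟩
        have h2 : τ b = b := this
        rw [hτ] at h2
        exact ⟨⟨b, congrArg Subtype.val h2⟩, rfl⟩⟩ }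
  refine ⟨IsGaloisGroup.finiteDimensional G _ _, ?_⟩
  rw [← IsGaloisGroup.card_eq_finrank G, Nat.card_zpowers]
  exact ho

open Polynomial in
theorem s4main [IsAlgClosed K] (hC : IsPseudofiniteField (fixSubfield σ)) (hn : 1 ≤ n) :
    Module.finrank (fixSubfield σ) (fixPowIntermediateField σ n) = n := by
  obtain ⟨f, hf, hfn⟩ := s4exists hC hn
  obtain ⟨α, hα⟩ := IsAlgClosed.exists_aeval_eq_zero K f (degree_pos_of_irreducible hf).ne'
  have key : ∀ d, 1 ≤ d → (σ ^ d) α = α →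
      n ≤ Module.finrank (fixSubfield σ) (fixPowIntermediateField σ d) := by
    intro d hd h
    have := (s4finrank σ d hd).1
    let β : fixPowIntermediateField σ d := ⟨α, h⟩
    have h1 := minpoly.natDegree_le (A := fixSubfield σ) β
    have h2 : aeval β f = 0 := by
      apply Subtype.ext
      have := aeval_algebraMap_apply K β f
      exact this.symm.trans hα
    rw [← minpoly.eq_of_irreducible hf h2, natDegree_mul_C (by simpa using hf.ne_zero), hfn] at h1
    exact h1
  have hroot : ∀ i : ℕ, aeval ((σ ^ i) α) f = 0 := by
    intro i
    let τ : K →ₐ[fixSubfield σ] K :=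
      { ((σ ^ i : K ≃+* K) : K →+* K) with commutes' := fun c => fixSubfield_pow c.2 i }
    have : aeval (τ α) f = τ (aeval α f) := aeval_algHom_apply τ α f
    rw [hα, map_zero] at this
    exact this
  obtain ⟨d, hd, hdn, hdα⟩ : ∃ d, 1 ≤ d ∧ d ≤ n ∧ (σ ^ d) α = α := by
    classical
    have hcard : (f.aroots K).toFinset.card < (Finset.range (n + 1)).card := by
      rw [Finset.card_range]
      have := (Multiset.toFinset_card_le (f.aroots K)).trans (card_roots' _)
      rw [natDegree_map, hfn] at this
      omega
    obtain ⟨i, hi, j, hj, hij, h⟩ := Finset.exists_ne_map_eq_of_card_lt_of_maps_to hcard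
      (f := fun i => (σ ^ i) α) (fun i _ => by
        simp only [Finset.mem_coe, Multiset.mem_toFinset, mem_aroots]
        exact ⟨hf.ne_zero, hroot i⟩)
    have aux : ∀ i j, i < j → j < n + 1 → (σ ^ i) α = (σ ^ j) α →
        ∃ d, 1 ≤ d ∧ d ≤ n ∧ (σ ^ d) α = α := by
      intro i j hij hj h
      refine ⟨j - i, by omega, by omega, ?_⟩
      apply (σ ^ i).injective
      rw [← RingAut.mul_apply, ← pow_add, Nat.add_sub_cancel' hij.le, h]
    simp only [Finset.mem_range] at hi hj
    rcases lt_or_gt_of_ne hij with hlt | hlt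
    · exact aux i j hlt hj h
    · exact aux j i hlt hi h.symm
  have h1 := key d hd hdα
  have h2 := (s4finrank σ d hd).2
  obtain rfl : d = n := by omega
  omega

end

set_option synthInstance.maxHeartbeats 1000000 in
/-- If `K` is algebraically closed and `Fix(σ)` is pseudofinite, then `[Fix(σⁿ) : Fix(σ)] = n`
for every `n ≥ 1`; consequently the fields `Fix(σⁿ)` for `n ≥ 1` are pairwise distinct. -/
theorem statement4 {K : Type*} [Field K] [IsAlgClosed K] (σ : K ≃+* K)
    (hC : IsPseudofiniteField (fixSubfield σ)) :
    (∀ n : ℕ, 1 ≤ n → Module.finrank (fixSubfield σ) (fixPowIntermediateField σ n) = n) ∧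
    (∀ n m : ℕ, 1 ≤ n → 1 ≤ m → n ≠ m →
      fixPowIntermediateField σ n ≠ fixPowIntermediateField σ m) := by
  refine ⟨fun n hn => s4main σ n hC hn, fun n m hn hm hnm h => hnm ?_⟩
  rw [← s4main σ n hC hn, h, s4main σ m hC hm]
end

section
/- Let K be a field and σ a ring automorphism of K. Then the set Per(σ) := {x ∈ K : σⁿ(x) = x for some integer n ≥ 1} of σ-periodic points is a subfield of K, and the extension Per(σ)/Fix(σ) is a Galois (i.e. algebraic, normal and separable) extension. -/
theorem per_mul {K : Type*} [Field K] {σ : K ≃+* K} {x : K} {n : ℕ}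
    (hx : (σ ^ n) x = x) (m : ℕ) : (σ ^ (n * m)) x = x := by
  rw [pow_mul]
  exact fixSubfield_pow hx m

theorem per_common {K : Type*} [Field K] {σ : K ≃+* K} {x y : K}
    (hx : ∃ n : ℕ, 1 ≤ n ∧ (σ ^ n) x = x) (hy : ∃ n : ℕ, 1 ≤ n ∧ (σ ^ n) y = y) :
    ∃ n : ℕ, 1 ≤ n ∧ (σ ^ n) x = x ∧ (σ ^ n) y = y := by
  obtain ⟨n, hn, hx⟩ := hx
  obtain ⟨m, hm, hy⟩ := hy
  exact ⟨n * m, Nat.mul_pos hn hm, per_mul hx m, by rw [mul_comm]; exact per_mul hy n⟩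

/-- The periodic points. -/
def perField {K : Type*} [Field K] (σ : K ≃+* K) :
    IntermediateField (fixSubfield σ) K where
  carrier := {x : K | ∃ n : ℕ, 1 ≤ n ∧ (σ ^ n) x = x}
  mul_mem' := by
    intro a b ha hb
    obtain ⟨n, hn, h1, h2⟩ := per_common ha hb
    exact ⟨n, hn, by rw [map_mul, h1, h2]⟩
  one_mem' := ⟨1, le_rfl, map_one _⟩
  add_mem' := by
    intro a b ha hb
    obtain ⟨n, hn, h1, h2⟩ := per_common ha hb
    exact ⟨n, hn, by rw [map_add, h1, h2]⟩
  zero_mem' := ⟨1, le_rfl, map_zero _⟩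
  algebraMap_mem' := fun c => ⟨1, le_rfl, fixSubfield_pow c.2 1⟩
  inv_mem' := by
    rintro x ⟨n, hn, hx⟩
    exact ⟨n, hn, by rw [map_inv₀, hx]⟩

open Polynomial in
theorem per_key {K : Type*} [Field K] (σ : K ≃+* K) (x : perField σ) :
    ∃ (q : (fixSubfield σ)[X]) (S : Finset (perField σ)),
      x ∈ S ∧ q.map (algebraMap (fixSubfield σ) (perField σ)) = ∏ y ∈ S, (X - C y) := by
  classical
  obtain ⟨n, hn, hx⟩ := x.2
  have hmem : ∀ i : ℕ, (σ ^ i) (x : K) ∈ perField σ := fun i => ⟨n, hn, by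
    rw [← RingAut.mul_apply, ← pow_add, add_comm, pow_add, RingAut.mul_apply, hx]⟩
  let S : Finset (perField σ) := (Finset.range n).image fun i => ⟨(σ ^ i) (x : K), hmem i⟩
  let T : Finset K := S.map ⟨Subtype.val, Subtype.val_injective⟩
  have hT : ∀ y, y ∈ T ↔ ∃ i < n, (σ ^ i) (x : K) = y := by
    intro y
    simp only [T, S, Finset.mem_map, Finset.mem_image, Finset.mem_range,
      Function.Embedding.coeFn_mk]
    constructor
    · rintro ⟨_, ⟨i, hi, rfl⟩, rfl⟩
      exact ⟨i, hi, rfl⟩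
    · rintro ⟨i, hi, rfl⟩
      exact ⟨_, ⟨i, hi, rfl⟩, rfl⟩
  have hsub : T.image σ ⊆ T := by
    intro y hy
    obtain ⟨z, hz, rfl⟩ := Finset.mem_image.1 hy
    obtain ⟨i, hi, rfl⟩ := (hT z).1 hz
    rw [hT, ← RingAut.mul_apply, ← pow_succ']
    rcases Nat.lt_or_ge (i + 1) n with h | h
    · exact ⟨i + 1, h, rfl⟩
    · have : i + 1 = n := by omega
      exact ⟨0, hn, by rw [this, hx]; rfl⟩
  have himg : T.image σ = T := Finset.eq_of_subset_of_card_le hsub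
    (Finset.card_image_of_injective _ σ.injective).ge
  have hmap : (∏ y ∈ T, (X - C y)).map (σ : K →+* K) = ∏ y ∈ T, (X - C y) := by
    rw [Polynomial.map_prod]
    conv_rhs => rw [← himg, Finset.prod_image σ.injective.injOn]
    simp
  have hlift : ∏ y ∈ T, (X - C y) ∈ Polynomial.lifts (algebraMap (fixSubfield σ) K) := by
    rw [Polynomial.lifts_iff_coeff_lifts]
    intro k
    refine ⟨⟨(∏ y ∈ T, (X - C y)).coeff k, ?_⟩, rfl⟩
    have := congrArg (fun p => p.coeff k) hmap
    simp only [Polynomial.coeff_map] at this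
    exact this
  obtain ⟨q, hq⟩ := (Polynomial.mem_lifts _).1 hlift
  refine ⟨q, S, ?_, ?_⟩
  · exact Finset.mem_image.2 ⟨0, Finset.mem_range.2 hn, rfl⟩
  · apply Polynomial.map_injective (algebraMap (perField σ) K) (algebraMap (perField σ) K).injective
    rw [Polynomial.map_map, ← IsScalarTower.algebraMap_eq, hq, Polynomial.map_prod, Finset.prod_map]
    simp

open Polynomial in
theorem per_min {K : Type*} [Field K] (σ : K ≃+* K) (x : perField σ) :
    IsIntegral (fixSubfield σ) x ∧ (minpoly (fixSubfield σ) x).Separable ∧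
      ((minpoly (fixSubfield σ) x).map (algebraMap (fixSubfield σ) (perField σ))).Splits := by
  obtain ⟨q, S, hxS, hq⟩ := per_key σ x
  have hmonic : q.Monic := by
    apply Polynomial.monic_of_injective (algebraMap (fixSubfield σ) (perField σ)).injective
    rw [hq]
    exact Polynomial.monic_prod_of_monic _ _ fun y _ => monic_X_sub_C y
  have hroot : aeval x q = 0 := by
    rw [aeval_def, ← eval_map, hq, eval_prod]
    exact Finset.prod_eq_zero hxS (by simp)
  have hdvd := minpoly.dvd (fixSubfield σ) x hroot
  refine ⟨⟨q, hmonic, hroot⟩, ?_, ?_⟩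
  · refine Separable.of_dvd ?_ hdvd
    rw [← Polynomial.separable_map (algebraMap (fixSubfield σ) (perField σ)), hq]
    exact (separable_prod_X_sub_C_iff' (f := fun y => y)).2 fun _ _ _ _ h => h
  · refine Splits.of_dvd ?_ (hmonic.map _).ne_zero (Polynomial.map_dvd _ hdvd)
    rw [hq]
    exact Splits.prod fun y _ => Splits.X_sub_C y

set_option synthInstance.maxHeartbeats 1000000 in
/-- The set `Per(σ)` of `σ`-periodic points is a subfield of `K` (containing `Fix(σ)`), and
the extension `Per(σ)/Fix(σ)` is Galois. -/
theorem statement6 {K : Type*} [Field K] (σ : K ≃+* K) :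
    ∃ P : IntermediateField (fixSubfield σ) K,
      (P : Set K) = {x : K | ∃ n : ℕ, 1 ≤ n ∧ (σ ^ n) x = x} ∧
      IsGalois (fixSubfield σ) P := by
  refine ⟨perField σ, rfl, ?_⟩
  have h1 : Algebra.IsSeparable (fixSubfield σ) (perField σ) := ⟨fun x => (per_min σ x).2.1⟩
  have h2 : Normal (fixSubfield σ) (perField σ) :=
    normal_iff.2 fun x => ⟨(per_min σ x).1, (per_min σ x).2.2⟩
  exact ⟨⟩
end
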